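/- Let φ be a C³ solution of ∂_t²φ − Δφ = −|φ|^{p−1}φ on ℝ^{1+2}, p > 1. With the vector field X = (x₂² + (t−x₁)² + 1)∂_t + (x₂² − (t−x₁)²)∂₁ + 2(t−x₁)x₂∂₂ and the function χ = t − x₁, the associated current J_μ := T_{μν}X^ν − ½(∂_μχ)φ² + ½χ∂_μ(φ²) satisfies the pointwise divergence identity ∂^μ J_μ = ((5−p)/(p+1)) (x₁ − t) |φ|^{p+1} everywhere on ℝ^{1+2}. -/

import Mathlib

noncomputable section

open MeasureTheory Real Set Filter Pointwise

/-- The Euclidean plane. -/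
abbrev E2 : Type := EuclideanSpace ℝ (Fin 2)

/-- Time derivative `∂ₜφ`. -/
def pt (φ : ℝ → E2 → ℝ) (t : ℝ) (x : E2) : ℝ := deriv (fun s => φ s x) t

/-- Second time derivative `∂ₜ²φ`. -/
def ptt (φ : ℝ → E2 → ℝ) (t : ℝ) (x : E2) : ℝ := deriv (fun s => pt φ s x) t

/-- Spatial partial derivative `∂ᵢ f` in the `i`-th coordinate direction. -/
def pdx (i : Fin 2) (f : E2 → ℝ) (x : E2) : ℝ := fderiv ℝ f x (EuclideanSpace.single i 1)

/-- Spatial Laplacian `Δf`. -/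
def lap (f : E2 → ℝ) (x : E2) : ℝ := ∑ i : Fin 2, pdx i (pdx i f) x

/-- Squared norm of the spatial gradient `|∇f|²`. -/
def gradSq (f : E2 → ℝ) (x : E2) : ℝ := ∑ i : Fin 2, (pdx i f x) ^ 2

/-- Squared norm of the spatial Hessian `|∇²f|²`. -/
def hessSq (f : E2 → ℝ) (x : E2) : ℝ := ∑ i : Fin 2, ∑ j : Fin 2, (pdx i (pdx j f) x) ^ 2

/-- Spacetime derivative `∂_μ φ` for `μ = 0, 1, 2` (with `∂₀ = ∂_t`). -/
def sd (φ : ℝ → E2 → ℝ) : Fin 3 → ℝ → E2 → ℝ :=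
  ![pt φ, fun t x => pdx 0 (φ t) x, fun t x => pdx 1 (φ t) x]

/-- The Minkowski metric `m = diag(-1, 1, 1)` on `ℝ^{1+2}`. -/
def mink (μ ν : Fin 3) : ℝ := if μ = ν then (if μ = 0 then -1 else 1) else 0

/-- `∂^σφ ∂_σφ + (2/(p+1))|φ|^{p+1}`. -/
def lagr (p : ℝ) (φ : ℝ → E2 → ℝ) (t : ℝ) (x : E2) : ℝ :=
  -(pt φ t x)^2 + (pdx 0 (φ t) x)^2 + (pdx 1 (φ t) x)^2 + (2/(p+1)) * |φ t x| ^ (p+1)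

/-- The energy-momentum tensor `T_{μν}`. -/
def Tten (p : ℝ) (φ : ℝ → E2 → ℝ) (μ ν : Fin 3) (t : ℝ) (x : E2) : ℝ :=
  sd φ μ t x * sd φ ν t x - (1/2) * mink μ ν * lagr p φ t x

/-- The current `J_μ := T_{μν}X^ν - ½(∂_μχ)φ² + ½χ∂_μ(φ²)`. -/
def Jcur (p : ℝ) (φ : ℝ → E2 → ℝ) (X : Fin 3 → ℝ → E2 → ℝ) (χ : ℝ → E2 → ℝ)
    (μ : Fin 3) (t : ℝ) (x : E2) : ℝ :=
  (∑ ν : Fin 3, Tten p φ μ ν t x * X ν t x)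
    - (1/2) * sd χ μ t x * (φ t x)^2
    + (1/2) * χ t x * sd (fun s y => (φ s y)^2) μ t x

/-- The Minkowski divergence `∂^μ J_μ = -∂ₜJ₀ + ∂₁J₁ + ∂₂J₂` of the current. -/
def divJ (p : ℝ) (φ : ℝ → E2 → ℝ) (X : Fin 3 → ℝ → E2 → ℝ) (χ : ℝ → E2 → ℝ)
    (t : ℝ) (x : E2) : ℝ :=
  -(pt (Jcur p φ X χ 0) t x)
    + pdx 0 (fun y => Jcur p φ X χ 1 t y) x
    + pdx 1 (fun y => Jcur p φ X χ 2 t y) x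

/-- The vector field `X = (x₂²+(t-x₁)²+1)∂ₜ + (x₂²-(t-x₁)²)∂₁ + 2(t-x₁)x₂∂₂`. -/
def X1 : Fin 3 → ℝ → E2 → ℝ :=
  ![fun t x => (x 1)^2 + (t - x 0)^2 + 1,
    fun t x => (x 1)^2 - (t - x 0)^2,
    fun t x => 2 * (t - x 0) * (x 1)]

/-- The multiplier function `χ = t - x₁`. -/
def chi1 : ℝ → E2 → ℝ := fun t x => t - x 0

lemma HasFDerivAt.pt_eq {g : ℝ → E2 → ℝ} {g' : ℝ × E2 →L[ℝ] ℝ} {t : ℝ} {x : E2}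
    (hg : HasFDerivAt (fun q : ℝ × E2 => g q.1 q.2) g' (t, x)) : pt g t x = g' (1, 0) := by
  have hpath : HasDerivAt (fun s : ℝ => (s, x)) ((1 : ℝ), (0 : E2)) t :=
    (hasDerivAt_id t).prodMk (hasDerivAt_const t x)
  exact (hg.comp_hasDerivAt t hpath).deriv

lemma HasFDerivAt.pdx_eq {g : ℝ → E2 → ℝ} {g' : ℝ × E2 →L[ℝ] ℝ} {t : ℝ} {x : E2}
    (hg : HasFDerivAt (fun q : ℝ × E2 => g q.1 q.2) g' (t, x)) (i : Fin 2) :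
    pdx i (g t) x = g' (0, EuclideanSpace.single i 1) := by
  have hslice : HasFDerivAt (g t) (g'.comp (ContinuousLinearMap.inr ℝ ℝ E2)) x :=
    HasFDerivAt.comp x hg (hasFDerivAt_prodMk_right t x)
  simp [pdx, hslice.fderiv]

lemma hasFDerivAt_fderiv_apply {M : Type*} [NormedAddCommGroup M] [NormedSpace ℝ M]
    {f : M → ℝ} (hf : ContDiff ℝ 2 f) (q v : M) :
    HasFDerivAt (fun r => fderiv ℝ f r v) ((fderiv ℝ (fderiv ℝ f) q).flip v) q := by
  have hd : DifferentiableAt ℝ (fderiv ℝ f) q :=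
    (hf.fderiv_right (m := 1) (by norm_num)).differentiable (by norm_num) q
  simpa using hd.hasFDerivAt.clm_apply (hasFDerivAt_const v q)

lemma hasFDerivAt_coord (i : Fin 2) (q : ℝ × E2) :
    HasFDerivAt (fun r : ℝ × E2 => r.2 i)
      ((EuclideanSpace.proj i : E2 →L[ℝ] ℝ).comp (ContinuousLinearMap.snd ℝ ℝ E2)) q :=
  ((EuclideanSpace.proj i : E2 →L[ℝ] ℝ).comp (ContinuousLinearMap.snd ℝ ℝ E2)).hasFDerivAt

lemma hasFDerivAt_chi1 (q : ℝ × E2) :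
    HasFDerivAt (fun r : ℝ × E2 => chi1 r.1 r.2)
      (ContinuousLinearMap.fst ℝ ℝ E2 -
        (EuclideanSpace.proj 0 : E2 →L[ℝ] ℝ).comp (ContinuousLinearMap.snd ℝ ℝ E2)) q :=
  hasFDerivAt_fst.sub (hasFDerivAt_coord 0 q)

lemma sd_chi1 (μ : Fin 3) (t : ℝ) (x : E2) : sd chi1 μ t x = ![1, -1, 0] μ := by
  have h := hasFDerivAt_chi1 (t, x)
  fin_cases μ
  · simp [sd, h.pt_eq]
  · simp [sd, h.pdx_eq]
  · simp [sd, h.pdx_eq]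

lemma sd_sq {φ : ℝ → E2 → ℝ} {t : ℝ} {x : E2}
    (hφ : DifferentiableAt ℝ (fun q : ℝ × E2 => φ q.1 q.2) (t, x)) (μ : Fin 3) :
    sd (fun s y => (φ s y) ^ 2) μ t x = 2 * φ t x * sd φ μ t x := by
  have h := hφ.hasFDerivAt
  have h2 : HasFDerivAt (fun q : ℝ × E2 => (φ q.1 q.2) ^ 2) _ (t, x) := h.pow 2
  have e0 := HasFDerivAt.pt_eq (g := fun s y => (φ s y) ^ 2) h2
  have e := HasFDerivAt.pdx_eq (g := fun s y => (φ s y) ^ 2) h2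
  fin_cases μ
  · simp [sd, h.pt_eq, e0]
  · simp [sd, h.pdx_eq, e]
  · simp [sd, h.pdx_eq, e]

/-- pointwise divergence identity for the current associated with `X₁`. -/
theorem divergence_identity_X1
    (p : ℝ) (hp : 1 < p)
    (φ : ℝ → E2 → ℝ)
    (hsm : ContDiff ℝ 3 (fun q : ℝ × E2 => φ q.1 q.2))
    (hsol : ∀ (t : ℝ) (x : E2), ptt φ t x - lap (φ t) x = -(|φ t x| ^ (p-1) * φ t x)) :
    ∀ (t : ℝ) (x : E2),
      divJ p φ X1 chi1 t x = ((5-p)/(p+1)) * (x 0 - t) * |φ t x| ^ (p+1) := by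
  intro t x
  have hC2 : ContDiff ℝ 2 (fun q : ℝ × E2 => φ q.1 q.2) := hsm.of_le (by norm_num)
  have hdiff : Differentiable ℝ (fun q : ℝ × E2 => φ q.1 q.2) := hC2.differentiable (by norm_num)
  have hf (q : ℝ × E2) : HasFDerivAt (fun q : ℝ × E2 => φ q.1 q.2)
      (fderiv ℝ (fun q : ℝ × E2 => φ q.1 q.2) q) q := (hdiff q).hasFDerivAt
  have hsymm := hC2.contDiffAt.isSymmSndFDerivAt (x := (t, x)) (by simp)
  have ha : HasFDerivAt (fun q : ℝ × E2 => pt φ q.1 q.2) _ (t, x) :=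
    (hasFDerivAt_fderiv_apply hC2 (t, x) (1, 0)).congr_of_eventuallyEq
      (.of_forall fun q => (hf q).pt_eq)
  have hb (i : Fin 2) : HasFDerivAt (fun q : ℝ × E2 => pdx i (φ q.1) q.2) _ (t, x) :=
    (hasFDerivAt_fderiv_apply hC2 (t, x) (0, EuclideanSpace.single i 1)).congr_of_eventuallyEq
      (.of_forall fun q => (hf q).pdx_eq i)
  have hP : HasFDerivAt (fun q : ℝ × E2 => |φ q.1 q.2| ^ (p + 1)) _ (t, x) :=
    HasDerivAt.comp_hasFDerivAt (h₂ := fun y => |y| ^ (p + 1)) (t, x)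
      (hasDerivAt_abs_rpow (φ t x) (by linarith)) (hf (t, x))
  have hwave := hsol t x
  have ett : ptt φ t x = _ := ha.pt_eq
  have exx (i : Fin 2) : pdx i (pdx i (φ t)) x = _ :=
    HasFDerivAt.pdx_eq (g := fun t x => pdx i (φ t) x) (hb i) i
  simp only [lap, Fin.sum_univ_two, ett, exx, ContinuousLinearMap.flip_apply] at hwave
  have hL : HasFDerivAt (fun q : ℝ × E2 => lagr p φ q.1 q.2) _ (t, x) :=
    (((ha.pow 2).fun_neg.fun_add ((hb 0).pow 2)).fun_add ((hb 1).pow 2)).fun_add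
      (hP.const_mul (2 / (p + 1)))
  have hu := hasFDerivAt_chi1 (t, x)
  have hy := hasFDerivAt_coord 1 (t, x)
  have hX0 : HasFDerivAt (fun q : ℝ × E2 => X1 0 q.1 q.2) _ (t, x) :=
    ((hy.pow 2).fun_add (hu.pow 2)).add_const 1
  have hX1 : HasFDerivAt (fun q : ℝ × E2 => X1 1 q.1 q.2) _ (t, x) :=
    (hy.pow 2).fun_sub (hu.pow 2)
  have hX2 : HasFDerivAt (fun q : ℝ × E2 => X1 2 q.1 q.2) _ (t, x) :=
    (hu.const_mul 2).fun_mul hy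
  have hX (ν : Fin 3) : DifferentiableAt ℝ (fun q : ℝ × E2 => X1 ν q.1 q.2) (t, x) := by
    fin_cases ν
    exacts [hX0.differentiableAt, hX1.differentiableAt, hX2.differentiableAt]
  have hs (ν : Fin 3) : DifferentiableAt ℝ (fun q : ℝ × E2 => sd φ ν q.1 q.2) (t, x) := by
    fin_cases ν
    exacts [ha.differentiableAt, (hb 0).differentiableAt, (hb 1).differentiableAt]
  have hT (μ ν : Fin 3) : HasFDerivAt (fun q : ℝ × E2 => Tten p φ μ ν q.1 q.2) _ (t, x) :=
    ((hs μ).hasFDerivAt.fun_mul (hs ν).hasFDerivAt).fun_sub (hL.const_mul (1 / 2 * mink μ ν))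
  have hJ (μ : Fin 3) : HasFDerivAt (fun q : ℝ × E2 => Jcur p φ X1 chi1 μ q.1 q.2) _ (t, x) :=
    ((((HasFDerivAt.fun_sum (u := Finset.univ) fun ν _ =>
      (hT μ ν).fun_mul (hX ν).hasFDerivAt).fun_sub
      (((hf (t, x)).pow 2).const_mul (1 / 2 * ![1, -1, 0] μ))).fun_add
      ((hu.const_mul (1 / 2)).fun_mul
        (((hf (t, x)).const_mul 2).fun_mul (hs μ).hasFDerivAt))).congr_of_eventuallyEq
      (.of_forall fun q => by simp only [Jcur, sd_chi1, sd_sq (hdiff q)]))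
  have hs0 : fderiv ℝ (fun q : ℝ × E2 => sd φ 0 q.1 q.2) (t, x) = _ := ha.fderiv
  have hs1 : fderiv ℝ (fun q : ℝ × E2 => sd φ 1 q.1 q.2) (t, x) = _ := (hb 0).fderiv
  have hs2 : fderiv ℝ (fun q : ℝ × E2 => sd φ 2 q.1 q.2) (t, x) = _ := (hb 1).fderiv
  have hsv0 : sd φ 0 t x = pt φ t x := rfl
  have hsv1 : sd φ 1 t x = pdx 0 (φ t) x := rfl
  have hsv2 : sd φ 2 t x = pdx 1 (φ t) x := rfl
  have hXv0 : X1 0 t x = (x 1) ^ 2 + (t - x 0) ^ 2 + 1 := rfl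
  have hXv1 : X1 1 t x = (x 1) ^ 2 - (t - x 0) ^ 2 := rfl
  have hXv2 : X1 2 t x = 2 * (t - x 0) * x 1 := rfl
  have m01 := hsymm.eq (1, 0) (0, EuclideanSpace.single 0 1)
  have m02 := hsymm.eq (1, 0) (0, EuclideanSpace.single 1 1)
  have m12 := hsymm.eq (0, EuclideanSpace.single 0 1) (0, EuclideanSpace.single 1 1)
  have d0 := (hf (t, x)).pt_eq
  have d1 := (hf (t, x)).pdx_eq 0
  have d2 := (hf (t, x)).pdx_eq 1
  have hexp : p + 1 - 2 = p - 1 := by ring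
  have hpow : |φ t x| ^ (p + 1) = |φ t x| ^ (p - 1) * φ t x ^ 2 := by
    rw [← sq_abs, ← Real.rpow_natCast, ← Real.rpow_add_of_nonneg (abs_nonneg _) (by linarith)
      (by norm_num)]
    congr 1
    push_cast
    ring
  have hp1 : p + 1 ≠ 0 := by linarith
  rw [divJ, (hJ 0).pt_eq, HasFDerivAt.pdx_eq (g := Jcur p φ X1 chi1 1) (hJ 1) 0,
    HasFDerivAt.pdx_eq (g := Jcur p φ X1 chi1 2) (hJ 2) 1]
  simp [Fin.sum_univ_three, hs0, hs1, hs2, hX0.fderiv, hX1.fderiv, hX2.fderiv, mink, Tten, lagr,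
    hsv0, hsv1, hsv2, hXv0, hXv1, hXv2, chi1, ← d0, ← d1, ← d2]
  rw [m01, m02, m12, eq_add_of_sub_eq hwave, hexp, hpow]
  field_simp
  ring
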